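/- arXiv:2304.10572 — 4 statements merged into one kernel-verified Lean document; each statement's English description precedes it below -/
import Mathlib

section
/- Lower bound by vanilla overlap (Lemma 1): Suppose sim(x,x) = 1 for every element x and the threshold t satisfies 0 < t ≤ 1. Then the cardinality of the intersection Q ∩ C is at most the semantic overlap: |Q ∩ C| ≤ SO(Q, C). -/
variable {γ : Type*} [DecidableEq γ]

/-- Thresholded similarity: `sim x y` if it is at least `t`, else `0`. -/
noncomputable def simT (sim : γ → γ → ℝ) (t : ℝ) (x y : γ) : ℝ :=
  if t ≤ sim x y then sim x y else 0

/-- `M` is an (optional one-to-one) matching between `Q` and `C`. -/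
def IsMatching (Q C : Finset γ) (M : Finset (γ × γ)) : Prop :=
  M ⊆ Q ×ˢ C ∧ ∀ p ∈ M, ∀ p' ∈ M, p ≠ p' → p.1 ≠ p'.1 ∧ p.2 ≠ p'.2

/-- The score of a matching `M` with respect to edge weights `w`. -/
def score (w : γ → γ → ℝ) (M : Finset (γ × γ)) : ℝ :=
  ∑ p ∈ M, w p.1 p.2

/-- Semantic overlap: maximum thresholded-similarity score over all matchings. -/
noncomputable def SO (sim : γ → γ → ℝ) (t : ℝ) (Q C : Finset γ) : ℝ :=
  sSup {s : ℝ | ∃ M : Finset (γ × γ), IsMatching Q C M ∧ score (simT sim t) M = s}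
theorem vanilla_overlap_le_semantic_overlap
    (sim : γ → γ → ℝ) (h0 : ∀ x y, 0 ≤ sim x y) (h1 : ∀ x y, sim x y ≤ 1)
    (hrefl : ∀ x, sim x x = 1)
    (t : ℝ) (ht0 : 0 < t) (ht1 : t ≤ 1)
    (Q C : Finset γ) :
    ((Q ∩ C).card : ℝ) ≤ SO sim t Q C := by
  unfold SO
  apply le_csSup
  · refine ⟨∑ p ∈ Q ×ˢ C, simT sim t p.1 p.2, ?_⟩
    rintro s ⟨M, hM, rfl⟩
    unfold score
    apply Finset.sum_le_sum_of_subset_of_nonneg hM.1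
    intro p _ _
    unfold simT
    split_ifs
    · exact h0 _ _
    · exact le_rfl
  · refine ⟨(Q ∩ C).image (fun x => (x, x)), ⟨?_, ?_⟩, ?_⟩
    · intro p hp
      simp only [Finset.mem_image, Finset.mem_inter] at hp
      obtain ⟨x, hx, rfl⟩ := hp
      simpa using hx
    · intro p hp p' hp' hne
      simp only [Finset.mem_image] at hp hp'
      obtain ⟨x, hx, rfl⟩ := hp
      obtain ⟨y, hy, rfl⟩ := hp'
      have hxy : x ≠ y := fun h => hne (by rw [h])
      exact ⟨hxy, hxy⟩
    · unfold score
      rw [Finset.sum_image (fun x _ y _ h => congrArg Prod.fst h)]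
      simp [simT, hrefl, ht1]
end

section
/- Vanilla overlap is a special case of semantic overlap: Suppose sim(x,y) = 1 if x = y and sim(x,y) = 0 if x ≠ y, and the threshold t satisfies 0 < t ≤ 1. Then SO(Q, C) = |Q ∩ C|. -/
variable {γ : Type*} [DecidableEq γ]

theorem semantic_overlap_eq_vanilla_overlap
    (sim : γ → γ → ℝ) (hsim : ∀ x y, sim x y = if x = y then (1 : ℝ) else 0)
    (t : ℝ) (ht0 : 0 < t) (ht1 : t ≤ 1)
    (Q C : Finset γ) :
    SO sim t Q C = ((Q ∩ C).card : ℝ) := by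
  have hw : ∀ x y, simT sim t x y = if x = y then (1 : ℝ) else 0 := by
    intro x y
    unfold simT
    rw [hsim]
    by_cases h : x = y
    · simp [h, ht1]
    · simp [h]
  have hgr : IsGreatest {s : ℝ | ∃ M : Finset (γ × γ), IsMatching Q C M ∧
      score (simT sim t) M = s} ((Q ∩ C).card : ℝ) := by
    constructor
    · refine ⟨(Q ∩ C).image (fun x => (x, x)), ⟨?_, ?_⟩, ?_⟩
      · intro p hp
        simp only [Finset.mem_image, Finset.mem_inter] at hp
        obtain ⟨x, hx, rfl⟩ := hp
        simpa using hx
      · intro p hp p' hp' hne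
        simp only [Finset.mem_image] at hp hp'
        obtain ⟨x, _, rfl⟩ := hp
        obtain ⟨y, _, rfl⟩ := hp'
        have hxy : x ≠ y := fun h => hne (by rw [h])
        exact ⟨hxy, hxy⟩
      · unfold score
        rw [Finset.sum_image (by intro a _ b _ h; exact congrArg Prod.fst h)]
        simp [hw]
    · rintro s ⟨M, ⟨hsub, hM⟩, rfl⟩
      have h1 : score (simT sim t) M = ((M.filter (fun p => p.1 = p.2)).card : ℝ) := by
        unfold score
        simp [hw]
      rw [h1]
      have h2 : (M.filter (fun p => p.1 = p.2)).card ≤ (Q ∩ C).card := by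
        apply Finset.card_le_card_of_injOn Prod.fst
        · intro p hp
          have hp' := Finset.mem_filter.mp hp
          have hq := Finset.mem_product.mp (hsub hp'.1)
          exact Finset.mem_inter.mpr ⟨hq.1, hp'.2 ▸ hq.2⟩
        · intro p hp q hq h
          by_contra hne
          exact (hM p (Finset.mem_filter.mp hp).1 q (Finset.mem_filter.mp hq).1 hne).1 h
      exact_mod_cast h2
  exact hgr.csSup_eq
end

section
/- No-EM filter (Lemma 7): Let U be a finite collection of finite sets, and let LB, UB : Finset γ → ℝ satisfy LB(X) ≤ SO(Q,X) ≤ UB(X) for every X ∈ U. Let θ_ub be the k-th largest upper bound over U, i.e., θ_ub = max over size-k subcollections S ⊆ U of min_{X∈S} UB(X), where k ≤ |U|. If C ∈ U satisfies LB(C) ≥ θ_ub, then at most k − 1 sets of U have semantic overlap strictly greater than SO(Q,C), i.e., |{X ∈ U : SO(Q,X) > SO(Q,C)}| ≤ k − 1; hence C is guaranteed to be in a top-k result without computing its exact matching. -/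
variable {γ : Type*} [DecidableEq γ]

theorem no_em_filter
    (sim : γ → γ → ℝ) (h0 : ∀ x y, 0 ≤ sim x y) (h1 : ∀ x y, sim x y ≤ 1)
    (t : ℝ) (ht0 : 0 < t)
    (Q : Finset γ) (U : Finset (Finset γ))
    (LB UB : Finset γ → ℝ)
    (hLB : ∀ X ∈ U, LB X ≤ SO sim t Q X) (hUB : ∀ X ∈ U, SO sim t Q X ≤ UB X)
    (k : ℕ) (hk0 : 0 < k) (hk : k ≤ U.card)
    (C : Finset γ) (hC : C ∈ U)
    (hfilter : sSup {v : ℝ | ∃ S : Finset (Finset γ), S ⊆ U ∧ S.card = k ∧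
        v = sInf (UB '' ↑S)} ≤ LB C) :
    {X ∈ (↑U : Set (Finset γ)) | SO sim t Q C < SO sim t Q X}.ncard ≤ k - 1 := by
  classical
  by_contra hcon
  push Not at hcon
  have hset : {X ∈ (↑U : Set (Finset γ)) | SO sim t Q C < SO sim t Q X}
      = ↑(U.filter (fun X => SO sim t Q C < SO sim t Q X)) := by
    ext X; simp
  rw [hset, Set.ncard_coe_finset] at hcon
  obtain ⟨S, hS, hcard⟩ := Finset.exists_subset_card_eq
    (show k ≤ (U.filter (fun X => SO sim t Q C < SO sim t Q X)).card by omega)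
  have hSU : S ⊆ U := hS.trans (Finset.filter_subset _ _)
  have hne : S.Nonempty := Finset.card_pos.mp (by omega)
  have hfin : (UB '' (↑S : Set (Finset γ))).Finite := S.finite_toSet.image _
  have hmem : sInf (UB '' (↑S : Set (Finset γ))) ∈ UB '' (↑S : Set (Finset γ)) :=
    (Set.Nonempty.image UB (Finset.coe_nonempty.mpr hne)).csInf_mem hfin
  obtain ⟨X, hX, hXe⟩ := hmem
  have hbdd : BddAbove {v : ℝ | ∃ S : Finset (Finset γ), S ⊆ U ∧ S.card = k ∧
        v = sInf (UB '' ↑S)} := by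
    apply Set.Finite.bddAbove
    apply (U.powerset.finite_toSet.image
      (fun S : Finset (Finset γ) => sInf (UB '' (↑S : Set (Finset γ))))).subset
    rintro v ⟨T, hT, -, rfl⟩
    exact ⟨T, by simpa using hT, rfl⟩
  have hle := le_csSup hbdd ⟨S, hSU, hcard, rfl⟩
  have hX' := (Finset.mem_filter.mp (hS hX)).2
  have h3 := hUB X (hSU hX)
  have h4 := hLB C hC
  linarith
end

section
/- EM-Early-Terminated filter (Lemma 8): Let 𝓛 be a finite collection of finite sets, let LB : Finset γ → ℝ satisfy LB(X) ≤ SO(Q,X) for every X ∈ 𝓛, let R ⊆ 𝓛 with |R| = k, and set θ_lb = min_{X∈R} LB(X). Let C ∈ 𝓛 and suppose ℓ_Q, ℓ_C : γ → ℝ are nonnegative node labelings with ℓ_Q(q) + ℓ_C(c) ≥ sim_t(q,c) for all q ∈ Q and c ∈ C (feasible labels maintained by the Hungarian algorithm). If Σ_{q∈Q} ℓ_Q(q) + Σ_{c∈C} ℓ_C(c) < θ_lb, then at least k sets of 𝓛 have semantic overlap strictly greater than SO(Q,C); hence C can be safely pruned and the graph-matching computation terminated early. -/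
variable {γ : Type*} [DecidableEq γ]

theorem em_early_terminated_filter
    (sim : γ → γ → ℝ) (h0 : ∀ x y, 0 ≤ sim x y) (h1 : ∀ x y, sim x y ≤ 1)
    (t : ℝ) (ht0 : 0 < t)
    (Q : Finset γ) (L : Finset (Finset γ))
    (LB : Finset γ → ℝ) (hLB : ∀ X ∈ L, LB X ≤ SO sim t Q X)
    (k : ℕ) (R : Finset (Finset γ)) (hR : R ⊆ L) (hRcard : R.card = k)
    (C : Finset γ) (hC : C ∈ L)
    (lQ lC : γ → ℝ)
    (hlQ : ∀ q ∈ Q, 0 ≤ lQ q) (hlC : ∀ c ∈ C, 0 ≤ lC c)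
    (hfeas : ∀ q ∈ Q, ∀ c ∈ C, simT sim t q c ≤ lQ q + lC c)
    (hlt : ∑ q ∈ Q, lQ q + ∑ c ∈ C, lC c < sInf (LB '' ↑R)) :
    k ≤ {X ∈ (↑L : Set (Finset γ)) | SO sim t Q C < SO sim t Q X}.ncard := by
  have hSO : SO sim t Q C ≤ ∑ q ∈ Q, lQ q + ∑ c ∈ C, lC c := by
    unfold SO
    apply csSup_le
    · exact ⟨_, ∅, ⟨by simp, by simp⟩, rfl⟩
    · rintro s ⟨M, ⟨hM, hinj⟩, rfl⟩
      have hmem : ∀ p ∈ M, p.1 ∈ Q ∧ p.2 ∈ C := fun p hp => Finset.mem_product.mp (hM hp)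
      have e1 : ∑ p ∈ M, lQ p.1 ≤ ∑ q ∈ Q, lQ q := by
        rw [← Finset.sum_image (s := M) (g := Prod.fst) (f := lQ)]
        · apply Finset.sum_le_sum_of_subset_of_nonneg
          · intro q hq
            obtain ⟨p, hp, rfl⟩ := Finset.mem_image.mp hq
            exact (hmem p hp).1
          · intro q hq _
            exact hlQ q hq
        · intro p hp p' hp' h
          by_contra hne
          exact (hinj p hp p' hp' hne).1 h
      have e2 : ∑ p ∈ M, lC p.2 ≤ ∑ c ∈ C, lC c := by
        rw [← Finset.sum_image (s := M) (g := Prod.snd) (f := lC)]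
        · apply Finset.sum_le_sum_of_subset_of_nonneg
          · intro q hq
            obtain ⟨p, hp, rfl⟩ := Finset.mem_image.mp hq
            exact (hmem p hp).2
          · intro q hq _
            exact hlC q hq
        · intro p hp p' hp' h
          by_contra hne
          exact (hinj p hp p' hp' hne).2 h
      have e3 : score (simT sim t) M ≤ ∑ p ∈ M, (lQ p.1 + lC p.2) :=
        Finset.sum_le_sum fun p hp => hfeas _ (hmem p hp).1 _ (hmem p hp).2
      rw [Finset.sum_add_distrib] at e3
      linarith
  rw [← hRcard, ← Set.ncard_coe_finset R]
  apply Set.ncard_le_ncard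
  · intro X hX
    have hX' : X ∈ R := hX
    refine ⟨hR hX', ?_⟩
    have h2 : sInf (LB '' (↑R : Set (Finset γ))) ≤ LB X :=
      csInf_le (R.finite_toSet.image LB).bddBelow ⟨X, hX, rfl⟩
    have h3 := hLB X (hR hX')
    linarith
  · exact L.finite_toSet.subset fun X hX => hX.1
end
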